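/- Let f : U → ℝ³ with unit normal ν be a frontal in orthogonal adapted coordinates (u,v) around a non-front singular point of the first kind at the origin p = (0,0) (so Ñ(p) = 0), with det(f_u, h, ν)(u,0) > 0. Let η̃ = −v²·F̃_v(p)·∂_u + ∂_v and let η̃^k f denote the k-fold iterated directional derivative of f along η̃. Then there exists l ∈ ℝ with η̃³f(p) = l·η̃²f(p), namely l = G̃_v(p), and the bias and secondary cuspidal curvature satisfy: ( |f_u|² · det(f_u, η̃²f, η̃⁴f) / |f_u × η̃²f|³ )(p) = 3·Ñ_v(p), and ( |f_u|^{5/2} · det(f_u, η̃²f, 3η̃⁵f − 10l·η̃⁴f) / |f_u × η̃²f|^{7/2} )(p) = 12·(Ñ_vv − 4F̃_v·M̃ − 2G̃_v·Ñ_v)(p), where × denotes the cross product in ℝ³. -/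

import Mathlib

noncomputable section

open Matrix Set
open scoped ContDiff

abbrev V3 : Type := Fin 3 → ℝ

/-- Partial derivative in the `u`-direction. -/
def Du {E : Type*} [NormedAddCommGroup E] [NormedSpace ℝ E] (g : ℝ × ℝ → E) (p : ℝ × ℝ) : E :=
  fderiv ℝ g p (1, 0)

/-- Partial derivative in the `v`-direction. -/
def Dv {E : Type*} [NormedAddCommGroup E] [NormedSpace ℝ E] (g : ℝ × ℝ → E) (p : ℝ × ℝ) : E :=
  fderiv ℝ g p (0, 1)

def det3 (a b c : V3) : ℝ := Matrix.det (Matrix.of ![a, b, c])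

def dot (x y : V3) : ℝ := x ⬝ᵥ y

def nrm (x : V3) : ℝ := Real.sqrt (dot x x)

def cross3 (x y : V3) : V3 := crossProduct x y

structure FrontalData where
  f : ℝ × ℝ → V3
  nu : ℝ × ℝ → V3
  h : ℝ × ℝ → V3

namespace FrontalData

def Et (X : FrontalData) (p : ℝ × ℝ) : ℝ := dot (Du X.f p) (Du X.f p)
def Ft (X : FrontalData) (p : ℝ × ℝ) : ℝ := dot (Du X.f p) (X.h p)
def Gt (X : FrontalData) (p : ℝ × ℝ) : ℝ := dot (X.h p) (X.h p)
def Lt (X : FrontalData) (p : ℝ × ℝ) : ℝ := -(dot (Du X.f p) (Du X.nu p))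
def Mt (X : FrontalData) (p : ℝ × ℝ) : ℝ := -(dot (X.h p) (Du X.nu p))
def Nt (X : FrontalData) (p : ℝ × ℝ) : ℝ := -(dot (X.h p) (Dv X.nu p))

def EGF (X : FrontalData) (p : ℝ × ℝ) : ℝ := X.Et p * X.Gt p - (X.Ft p) ^ 2

/-- `f` is a frontal with unit normal `nu`, in adapted coordinates around a singular point of
the first kind at the origin: `f_v = v • h` and `{f_u, h, nu}` is a frame. -/
def IsAdapted (X : FrontalData) (U : Set (ℝ × ℝ)) : Prop :=
  IsOpen U ∧ (0, 0) ∈ U ∧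
  ContDiff ℝ ∞ X.f ∧ ContDiff ℝ ∞ X.nu ∧ ContDiff ℝ ∞ X.h ∧
  (∀ p ∈ U, dot (X.nu p) (X.nu p) = 1) ∧
  (∀ p ∈ U, dot (Du X.f p) (X.nu p) = 0) ∧
  (∀ p ∈ U, dot (Dv X.f p) (X.nu p) = 0) ∧
  (∀ p ∈ U, Dv X.f p = p.2 • X.h p) ∧
  (∀ p ∈ U, det3 (Du X.f p) (X.h p) (X.nu p) ≠ 0) ∧
  (∀ p ∈ U, 0 < X.EGF p)

/-- orthogonal adapted coordinates -/
def IsOrthogonal (X : FrontalData) (U : Set (ℝ × ℝ)) : Prop :=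
  ∀ u : ℝ, (u, 0) ∈ U → X.Et (u, 0) = 1 ∧ X.Gt (u, 0) = 1 ∧ X.Ft (u, 0) = 0

/-- Gaussian curvature on `{v ≠ 0}`. -/
def Kdef (X : FrontalData) (p : ℝ × ℝ) : ℝ :=
  (X.Lt p * X.Nt p - p.2 * (X.Mt p) ^ 2) / (p.2 * X.EGF p)

/-- Mean curvature on `{v ≠ 0}`. -/
def Hdef (X : FrontalData) (p : ℝ × ℝ) : ℝ :=
  (X.Et p * X.Nt p - 2 * p.2 * X.Ft p * X.Mt p + p.2 * X.Gt p * X.Lt p) / (2 * p.2 * X.EGF p)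

/-- Principal curvatures on `{v ≠ 0}`. -/
def kap1 (X : FrontalData) (p : ℝ × ℝ) : ℝ := X.Hdef p + Real.sqrt ((X.Hdef p) ^ 2 - X.Kdef p)
def kap2 (X : FrontalData) (p : ℝ × ℝ) : ℝ := X.Hdef p - Real.sqrt ((X.Hdef p) ^ 2 - X.Kdef p)

/-- Limiting normal curvature along the singular curve. -/
def kapNu (X : FrontalData) (u : ℝ) : ℝ := X.Lt (u, 0)
/-- Cuspidal torsion along the singular curve. -/
def kapT (X : FrontalData) (u : ℝ) : ℝ := X.Mt (u, 0)
/-- Bias along the singular curve. -/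
def rb (X : FrontalData) (u : ℝ) : ℝ := 3 * Dv X.Nt (u, 0)
/-- Secondary cuspidal curvature along the singular curve. -/
def rc (X : FrontalData) (u : ℝ) : ℝ :=
  12 * (Dv (Dv X.Nt) (u, 0) - 4 * Dv X.Ft (u, 0) * X.Mt (u, 0) -
    2 * Dv X.Gt (u, 0) * Dv X.Nt (u, 0))

end FrontalData

/-- Directional derivative of a map along the vector field `a ∂_u + ∂_v`. -/
def etaD (a : ℝ × ℝ → ℝ) (g : ℝ × ℝ → V3) : ℝ × ℝ → V3 :=
  fun p => a p • Du g p + Dv g p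
section PartialDerivatives

variable {E : Type*} [NormedAddCommGroup E] [NormedSpace ℝ E]

lemma ContDiff.Du {g : ℝ × ℝ → E} (hg : ContDiff ℝ ∞ g) : ContDiff ℝ ∞ (Du g) :=
  (hg.fderiv_right (m := ∞) (by simp)).clm_apply contDiff_const

lemma ContDiff.Dv {g : ℝ × ℝ → E} (hg : ContDiff ℝ ∞ g) : ContDiff ℝ ∞ (Dv g) :=
  (hg.fderiv_right (m := ∞) (by simp)).clm_apply contDiff_const

lemma ContDiff.differentiableAt_of_smooth {g : ℝ × ℝ → E} (hg : ContDiff ℝ ∞ g) (p : ℝ × ℝ) :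
    DifferentiableAt ℝ g p :=
  hg.differentiable (by simp) p

lemma Filter.EventuallyEq.Du {g k : ℝ × ℝ → E} {p : ℝ × ℝ} (hgk : g =ᶠ[nhds p] k) :
    Du g =ᶠ[nhds p] Du k :=
  hgk.fderiv.fun_comp (fun L : ℝ × ℝ →L[ℝ] E => L (1, 0))

lemma Filter.EventuallyEq.Dv {g k : ℝ × ℝ → E} {p : ℝ × ℝ} (hgk : g =ᶠ[nhds p] k) :
    Dv g =ᶠ[nhds p] Dv k :=
  hgk.fderiv.fun_comp (fun L : ℝ × ℝ →L[ℝ] E => L (0, 1))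

lemma Du_add {g k : ℝ × ℝ → E} (hg : ContDiff ℝ ∞ g) (hk : ContDiff ℝ ∞ k) :
    Du (g + k) = Du g + Du k := by
  funext p
  simp [Du, fderiv_add (hg.differentiableAt_of_smooth p) (hk.differentiableAt_of_smooth p)]

lemma Dv_add {g k : ℝ × ℝ → E} (hg : ContDiff ℝ ∞ g) (hk : ContDiff ℝ ∞ k) :
    Dv (g + k) = Dv g + Dv k := by
  funext p
  simp [Dv, fderiv_add (hg.differentiableAt_of_smooth p) (hk.differentiableAt_of_smooth p)]

lemma Du_smul {b : ℝ × ℝ → ℝ} {g : ℝ × ℝ → E} (hb : ContDiff ℝ ∞ b) (hg : ContDiff ℝ ∞ g) :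
    Du (b • g) = b • Du g + Du b • g := by
  funext p
  simp [Du, fderiv_smul (hb.differentiableAt_of_smooth p) (hg.differentiableAt_of_smooth p)]

lemma Dv_smul {b : ℝ × ℝ → ℝ} {g : ℝ × ℝ → E} (hb : ContDiff ℝ ∞ b) (hg : ContDiff ℝ ∞ g) :
    Dv (b • g) = b • Dv g + Dv b • g := by
  funext p
  simp [Dv, fderiv_smul (hb.differentiableAt_of_smooth p) (hg.differentiableAt_of_smooth p)]

lemma Du_snd : Du (Prod.snd : ℝ × ℝ → ℝ) = 0 := by
  funext p; simp [Du, fderiv_snd]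

lemma Dv_snd : Dv (Prod.snd : ℝ × ℝ → ℝ) = 1 := by
  funext p; simp [Dv, fderiv_snd]

lemma Dv_Du_comm {g : ℝ × ℝ → E} (hg : ContDiff ℝ ∞ g) : Dv (Du g) = Du (Dv g) := by
  funext p
  have hd : DifferentiableAt ℝ (fderiv ℝ g) p :=
    (hg.fderiv_right (m := ∞) (by simp)).differentiable (by simp) p
  have hs : IsSymmSndFDerivAt ℝ g p :=
    hg.contDiffAt.isSymmSndFDerivAt (by simp; exact WithTop.coe_le_coe.2 le_top)
  have key : ∀ x y : ℝ × ℝ, fderiv ℝ (fun q => fderiv ℝ g q x) p y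
      = fderiv ℝ (fderiv ℝ g) p y x := fun x y => by
    rw [fderiv_clm_apply hd (differentiableAt_const x)]; simp
  change fderiv ℝ (fun q => fderiv ℝ g q (1, 0)) p (0, 1)
    = fderiv ℝ (fun q => fderiv ℝ g q (0, 1)) p (1, 0)
  rw [key, key, hs.eq]

end PartialDerivatives

section DotProduct

lemma dot_eq (x y : V3) : dot x y = x 0 * y 0 + x 1 * y 1 + x 2 * y 2 := by
  simp [dot, dotProduct, Fin.sum_univ_three]

lemma dot_comm (x y : V3) : dot x y = dot y x := dotProduct_comm x y

lemma dot_add_left (x y z : V3) : dot (x + y) z = dot x z + dot y z := add_dotProduct x y z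

lemma dot_sub_left (x y z : V3) : dot (x - y) z = dot x z - dot y z := sub_dotProduct x y z

lemma dot_smul_left (r : ℝ) (x z : V3) : dot (r • x) z = r * dot x z := by
  simp [dot]

lemma ContDiff.dot {g k : ℝ × ℝ → V3} (hg : ContDiff ℝ ∞ g) (hk : ContDiff ℝ ∞ k) :
    ContDiff ℝ ∞ (fun p => dot (g p) (k p)) := by
  simp only [dot_eq]
  have h1 := contDiff_pi.1 hg
  have h2 := contDiff_pi.1 hk
  exact (((h1 0).mul (h2 0)).add ((h1 1).mul (h2 1))).add ((h1 2).mul (h2 2))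

lemma fderiv_dot {g k : ℝ × ℝ → V3} (hg : ContDiff ℝ ∞ g) (hk : ContDiff ℝ ∞ k)
    (p x : ℝ × ℝ) : fderiv ℝ (fun p => dot (g p) (k p)) p x
      = dot (fderiv ℝ g p x) (k p) + dot (g p) (fderiv ℝ k p x) := by
  have h1 := hasFDerivAt_pi'.1 (hg.differentiableAt_of_smooth p).hasFDerivAt
  have h2 := hasFDerivAt_pi'.1 (hk.differentiableAt_of_smooth p).hasFDerivAt
  have h := (((h1 0).mul (h2 0)).add ((h1 1).mul (h2 1))).add ((h1 2).mul (h2 2))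
  have hdot : (fun p => dot (g p) (k p)) =
      fun p => g p 0 * k p 0 + g p 1 * k p 1 + g p 2 * k p 2 :=
    funext fun p => dot_eq _ _
  rw [hdot]
  refine (congrArg (fun L : ℝ × ℝ →L[ℝ] ℝ => L x) h.fderiv).trans ?_
  simp [dot_eq]
  ring

lemma Du_dot {g k : ℝ × ℝ → V3} (hg : ContDiff ℝ ∞ g) (hk : ContDiff ℝ ∞ k) :
    Du (fun p => dot (g p) (k p)) = fun p => dot (Du g p) (k p) + dot (g p) (Du k p) :=
  funext fun p => fderiv_dot hg hk p _

lemma Dv_dot {g k : ℝ × ℝ → V3} (hg : ContDiff ℝ ∞ g) (hk : ContDiff ℝ ∞ k) :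
    Dv (fun p => dot (g p) (k p)) = fun p => dot (Dv g p) (k p) + dot (g p) (Dv k p) :=
  funext fun p => fderiv_dot hg hk p _

lemma det3_mul_det3 (a b w n : V3) : det3 a b w * det3 a b n =
    dot a a * (dot b b * dot w n - dot b n * dot w b)
      - dot a b * (dot a b * dot w n - dot b n * dot w a)
      + dot a n * (dot a b * dot w b - dot b b * dot w a) := by
  simp only [det3, Matrix.det_fin_three, dot_eq, Matrix.of_apply, Matrix.cons_val]
  ring

lemma dot_cross3_self (a b : V3) :
    dot (cross3 a b) (cross3 a b) = dot a a * dot b b - dot a b ^ 2 := by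
  simp only [cross3, cross_apply, dot_eq, Matrix.cons_val]
  ring

lemma det3_eq_dot_of_orthonormal {a b n : V3} (haa : dot a a = 1) (hbb : dot b b = 1)
    (hab : dot a b = 0) (hnn : dot n n = 1) (han : dot a n = 0) (hbn : dot b n = 0)
    (hpos : 0 < det3 a b n) (w : V3) : det3 a b w = dot w n := by
  have h1 : det3 a b n = 1 := by
    have := det3_mul_det3 a b n n
    rw [haa, hbb, hab, hnn, han, hbn] at this
    nlinarith
  have := det3_mul_det3 a b w n
  rw [haa, hbb, hab, han, hbn, h1] at this
  linarith

lemma eq_zero_of_dot_eq_zero {a b n w : V3} (hdet : det3 a b n ≠ 0) (ha : dot a w = 0)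
    (hb : dot b w = 0) (hn : dot n w = 0) : w = 0 := by
  refine Matrix.eq_zero_of_mulVec_eq_zero hdet ?_
  ext i
  fin_cases i
  · exact ha
  · exact hb
  · exact hn

end DotProduct

section DirectionalDerivative

variable {a : ℝ × ℝ → ℝ} {g k : ℝ × ℝ → V3}

lemma etaD_eq (a : ℝ × ℝ → ℝ) (g : ℝ × ℝ → V3) : etaD a g = a • Du g + Dv g := rfl

lemma ContDiff.etaD (ha : ContDiff ℝ ∞ a) (hg : ContDiff ℝ ∞ g) : ContDiff ℝ ∞ (etaD a g) :=
  (ha.smul hg.Du).add hg.Dv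

lemma Filter.EventuallyEq.etaD {p : ℝ × ℝ} (hgk : g =ᶠ[nhds p] k) :
    etaD a g =ᶠ[nhds p] etaD a k := by
  filter_upwards [hgk.Du, hgk.Dv] with q h1 h2
  simp [_root_.etaD, h1, h2]

lemma etaD_add (hg : ContDiff ℝ ∞ g) (hk : ContDiff ℝ ∞ k) :
    etaD a (g + k) = etaD a g + etaD a k := by
  simp only [etaD_eq, Du_add hg hk, Dv_add hg hk, smul_add]
  abel

lemma etaD_snd_smul (hg : ContDiff ℝ ∞ g) :
    etaD a ((Prod.snd : ℝ × ℝ → ℝ) • g) = (Prod.snd : ℝ × ℝ → ℝ) • etaD a g + g := by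
  simp only [etaD_eq, Du_smul contDiff_snd hg, Dv_smul contDiff_snd hg, Du_snd, Dv_snd]
  funext p
  simp only [Pi.add_apply, Pi.smul_apply', Pi.zero_apply, Pi.one_apply]
  module

/-- Iterated derivatives, at a point where `v = 0`, of a map whose derivative along `∂_v + a ∂_u`
is `v (v A + B)`. -/
lemma etaD_iterate_of_eventuallyEq {A B : ℝ × ℝ → V3} (ha : ContDiff ℝ ∞ a)
    (hA : ContDiff ℝ ∞ A) (hB : ContDiff ℝ ∞ B) {p : ℝ × ℝ} (hp : p.2 = 0)
    (hg : etaD a g =ᶠ[nhds p] (Prod.snd : ℝ × ℝ → ℝ) • ((Prod.snd : ℝ × ℝ → ℝ) • A + B)) :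
    etaD a (etaD a g) p = B p ∧
    etaD a (etaD a (etaD a g)) p = (2 : ℝ) • A p + (2 : ℝ) • etaD a B p ∧
    etaD a (etaD a (etaD a (etaD a g))) p
      = (6 : ℝ) • etaD a A p + (3 : ℝ) • etaD a (etaD a B) p ∧
    etaD a (etaD a (etaD a (etaD a (etaD a g)))) p
      = (12 : ℝ) • etaD a (etaD a A) p + (4 : ℝ) • etaD a (etaD a (etaD a B)) p := by
  have hs : ContDiff ℝ ∞ (Prod.snd : ℝ × ℝ → ℝ) := contDiff_snd
  -- Leibniz rule for products with `v`, iterated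
  have leib : ∀ {C : ℝ × ℝ → V3}, ContDiff ℝ ∞ C →
      etaD a (etaD a ((Prod.snd : ℝ × ℝ → ℝ) • C)) =
        (Prod.snd : ℝ × ℝ → ℝ) • etaD a (etaD a C) + (etaD a C + etaD a C) := fun {C} hC => by
    rw [etaD_snd_smul hC, etaD_add (hs.smul (ha.etaD hC)) hC, etaD_snd_smul (ha.etaD hC),
      add_assoc]
  have leib3 : ∀ {C : ℝ × ℝ → V3}, ContDiff ℝ ∞ C →
      etaD a (etaD a (etaD a ((Prod.snd : ℝ × ℝ → ℝ) • C))) =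
        (Prod.snd : ℝ × ℝ → ℝ) • etaD a (etaD a (etaD a C))
          + (etaD a (etaD a C) + (etaD a (etaD a C) + etaD a (etaD a C))) := fun {C} hC => by
    have h1 := ha.etaD hC
    have h2 := ha.etaD h1
    have h11 : ContDiff ℝ ∞ (etaD a C + etaD a C) := h1.add h1
    rw [leib hC, etaD_add (hs.smul h2) h11, etaD_snd_smul h2, etaD_add h1 h1, add_assoc]
  have leib4 : ∀ {C : ℝ × ℝ → V3}, ContDiff ℝ ∞ C →
      etaD a (etaD a (etaD a (etaD a ((Prod.snd : ℝ × ℝ → ℝ) • C)))) =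
        (Prod.snd : ℝ × ℝ → ℝ) • etaD a (etaD a (etaD a (etaD a C)))
          + (etaD a (etaD a (etaD a C)) + (etaD a (etaD a (etaD a C))
            + (etaD a (etaD a (etaD a C)) + etaD a (etaD a (etaD a C))))) := fun {C} hC => by
    have h1 := ha.etaD hC
    have h2 := ha.etaD h1
    have h3 := ha.etaD h2
    have h22 : ContDiff ℝ ∞ (etaD a (etaD a C) + etaD a (etaD a C)) := h2.add h2
    have h222 : ContDiff ℝ ∞ (etaD a (etaD a C) + (etaD a (etaD a C) + etaD a (etaD a C))) :=
      h2.add h22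
    rw [leib3 hC, etaD_add (hs.smul h3) h222, etaD_snd_smul h3, etaD_add h2 h22, etaD_add h2 h2, add_assoc]
  have hsA := hs.smul hA
  have hA1 := ha.etaD hA
  have hB1 := ha.etaD hB
  have hsA1 := ha.etaD hsA
  have hC : ContDiff ℝ ∞ ((Prod.snd : ℝ × ℝ → ℝ) • A + B) := hsA.add hB
  have e1 : etaD a ((Prod.snd : ℝ × ℝ → ℝ) • A + B)
      = etaD a ((Prod.snd : ℝ × ℝ → ℝ) • A) + etaD a B := etaD_add hsA hB
  have e2 : etaD a (etaD a ((Prod.snd : ℝ × ℝ → ℝ) • A + B))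
      = etaD a (etaD a ((Prod.snd : ℝ × ℝ → ℝ) • A)) + etaD a (etaD a B) := by
    rw [e1, etaD_add hsA1 hB1]
  have e3 : etaD a (etaD a (etaD a ((Prod.snd : ℝ × ℝ → ℝ) • A + B)))
      = etaD a (etaD a (etaD a ((Prod.snd : ℝ × ℝ → ℝ) • A))) + etaD a (etaD a (etaD a B)) := by
    rw [e2, etaD_add (ha.etaD hsA1) (ha.etaD hB1)]
  refine ⟨?_, ?_, ?_, ?_⟩
  · rw [hg.etaD.eq_of_nhds, etaD_snd_smul hC]
    simp [hp]
  · rw [hg.etaD.etaD.eq_of_nhds, leib hC, e1, etaD_snd_smul hA]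
    simp only [Pi.add_apply, Pi.smul_apply', hp]
    module
  · rw [hg.etaD.etaD.etaD.eq_of_nhds, leib3 hC, e2, leib hA]
    simp only [Pi.add_apply, Pi.smul_apply', hp]
    module
  · rw [hg.etaD.etaD.etaD.etaD.eq_of_nhds, leib4 hC, e3, leib3 hA]
    simp only [Pi.add_apply, Pi.smul_apply', hp]
    module

/-- Iterated derivatives along `c v² ∂_u + ∂_v` at a point where `v = 0`. -/
lemma etaD_iterate_of_sq {c : ℝ} (hg : ContDiff ℝ ∞ g)
    (ha : a = fun p => c * p.2 ^ 2) {p : ℝ × ℝ} (hp : p.2 = 0) :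
    etaD a g p = Dv g p ∧ etaD a (etaD a g) p = Dv (Dv g) p ∧
    etaD a (etaD a (etaD a g)) p = Dv (Dv (Dv g)) p + (2 * c) • Du g p := by
  have hs : ContDiff ℝ ∞ (Prod.snd : ℝ × ℝ → ℝ) := contDiff_snd
  have ha0 : a p = 0 := by simp [ha, hp]
  have hac : ContDiff ℝ ∞ a := ha ▸ contDiff_const.mul (contDiff_snd.pow 2)
  have ha1 : Dv a = fun p => 2 * c * p.2 := by
    have : a = (fun _ : ℝ × ℝ => c) • ((Prod.snd : ℝ × ℝ → ℝ) • (Prod.snd : ℝ × ℝ → ℝ)) := by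
      funext q; simp [ha, sq]
    rw [this, Dv_smul contDiff_const (hs.smul hs), Dv_smul hs hs, Dv_snd]
    funext q
    simp [Dv]
    ring
  have ha1' : ContDiff ℝ ∞ (Dv a) := hac.Dv
  have ha2 : Dv (Dv a) = fun _ => 2 * c := by
    have : Dv a = (fun _ : ℝ × ℝ => 2 * c) • (Prod.snd : ℝ × ℝ → ℝ) := by
      funext q; simp [ha1]
    rw [this, Dv_smul contDiff_const hs, Dv_snd]
    funext q
    simp [Dv]
  have ha1p : Dv a p = 0 := by simp [ha1, hp]
  have s1 : ∀ k : ℝ × ℝ → V3, etaD a k p = Dv k p := fun k => by simp [etaD, ha0]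
  have s2 : ∀ {k : ℝ × ℝ → V3}, ContDiff ℝ ∞ k → etaD a (etaD a k) p = Dv (Dv k) p :=
    fun {k} hk => by
      rw [s1, etaD_eq, Dv_add (hac.smul hk.Du) hk.Dv, Dv_smul hac hk.Du]
      simp [ha0, ha1p]
  refine ⟨s1 g, s2 hg, ?_⟩
  have h1 : ContDiff ℝ ∞ (a • Du g) := hac.smul hg.Du
  rw [s2 (hac.etaD hg), etaD_eq, Dv_add h1 hg.Dv, Dv_add h1.Dv hg.Dv.Dv, Dv_smul hac hg.Du,
    Dv_add (hac.smul hg.Du.Dv) (ha1'.smul hg.Du), Dv_smul hac hg.Du.Dv, Dv_smul ha1' hg.Du, ha2]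
  simp [ha0, ha1p, add_comm]

end DirectionalDerivative

/-- A smooth function `k` with `v k = 0` on an open set vanishes there. -/
lemma eq_zero_of_snd_mul_eq_zero {k : ℝ × ℝ → ℝ} {U : Set (ℝ × ℝ)} (hU : IsOpen U)
    (hk : ContDiff ℝ ∞ k) (h : ∀ p ∈ U, p.2 * k p = 0) : ∀ p ∈ U, k p = 0 := by
  intro p hp
  rcases mul_eq_zero.1 (h p hp) with h0 | h0
  · have he : ((Prod.snd : ℝ × ℝ → ℝ) • k) =ᶠ[nhds p] fun _ => 0 := by
      filter_upwards [hU.mem_nhds hp] with q hq using h q hq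
    have := he.Dv.eq_of_nhds
    rw [Dv_smul contDiff_snd hk, Dv_snd] at this
    simpa [h0, Dv] using this
  · exact h0

/-- with `η̃ = (-v² F̃_v(0,0)) ∂_u + ∂_v` one has `η̃³f(p) = l·η̃²f(p)` with
`l = G̃_v(p)`, and the bias and the secondary cuspidal curvature at the origin are
`r_b(p) = 3Ñ_v(p)` and `r_c(p) = 12(Ñ_vv − 4F̃_v M̃ − 2G̃_v Ñ_v)(p)`. -/
theorem stmt1 (X : FrontalData) (U : Set (ℝ × ℝ))
    (hA : X.IsAdapted U) (hO : X.IsOrthogonal U)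
    (hdetpos : ∀ u : ℝ, (u, 0) ∈ U →
      0 < det3 (Du X.f (u, 0)) (X.h (u, 0)) (X.nu (u, 0)))
    (hnf : X.Nt (0, 0) = 0)
    (a : ℝ × ℝ → ℝ) (ha : ∀ p : ℝ × ℝ, a p = -(p.2 ^ 2) * Dv X.Ft (0, 0)) :
    etaD a (etaD a (etaD a X.f)) (0, 0) = Dv X.Gt (0, 0) • etaD a (etaD a X.f) (0, 0) ∧
    (nrm (Du X.f (0, 0))) ^ 2 *
        det3 (Du X.f (0, 0)) (etaD a (etaD a X.f) (0, 0))
          (etaD a (etaD a (etaD a (etaD a X.f))) (0, 0)) /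
        (nrm (cross3 (Du X.f (0, 0)) (etaD a (etaD a X.f) (0, 0)))) ^ 3
      = 3 * Dv X.Nt (0, 0) ∧
    (nrm (Du X.f (0, 0))) ^ ((5 : ℝ) / 2) *
        det3 (Du X.f (0, 0)) (etaD a (etaD a X.f) (0, 0))
          ((3 : ℝ) • etaD a (etaD a (etaD a (etaD a (etaD a X.f)))) (0, 0) -
            (10 * Dv X.Gt (0, 0)) • etaD a (etaD a (etaD a (etaD a X.f))) (0, 0)) /
        (nrm (cross3 (Du X.f (0, 0)) (etaD a (etaD a X.f) (0, 0)))) ^ ((7 : ℝ) / 2)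
      = 12 * (Dv (Dv X.Nt) (0, 0) - 4 * Dv X.Ft (0, 0) * X.Mt (0, 0) -
          2 * Dv X.Gt (0, 0) * Dv X.Nt (0, 0)) := by
  obtain ⟨hU, h0, hf, hn, hh, hnn, hfn, hvn, hfv, hdet, -⟩ := hA
  obtain ⟨hE, hG, hF⟩ := hO 0 h0
  have hpos := hdetpos 0 h0
  have hUn : U ∈ nhds ((0, 0) : ℝ × ℝ) := hU.mem_nhds h0
  have hs : ContDiff ℝ ∞ (Prod.snd : ℝ × ℝ → ℝ) := contDiff_snd
  have hfu := hf.Du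
  have hhn : ∀ p ∈ U, dot (X.h p) (X.nu p) = 0 :=
    eq_zero_of_snd_mul_eq_zero hU (hh.dot hn) fun p hp => by
      rw [← dot_smul_left, ← hfv p hp]; exact hvn p hp
  have hfv' : Dv X.f =ᶠ[nhds (0, 0)] (Prod.snd : ℝ × ℝ → ℝ) • X.h := by
    filter_upwards [hUn] with p hp using hfv p hp
  -- mixed derivatives of `f`
  have hfuv : Dv (Du X.f) =ᶠ[nhds (0, 0)] (Prod.snd : ℝ × ℝ → ℝ) • Du X.h := by
    rw [Dv_Du_comm hf]
    refine hfv'.Du.trans (Filter.EventuallyEq.of_eq ?_)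
    rw [Du_smul hs hh, Du_snd, zero_smul, add_zero]
  have hfuv0 : Dv (Du X.f) (0, 0) = 0 := by rw [hfuv.eq_of_nhds]; simp
  have hfuvv0 : Dv (Dv (Du X.f)) (0, 0) = Du X.h (0, 0) := by
    rw [hfuv.Dv.eq_of_nhds, Dv_smul hs hh.Du, Dv_snd]; simp
  -- derivatives of the orthogonality relations
  have R1 : (fun p => dot (X.h p) (X.nu p)) =ᶠ[nhds (0, 0)] fun _ => 0 := by
    filter_upwards [hUn] with p hp using hhn p hp
  have R2 : (fun p => dot (Du X.f p) (X.nu p)) =ᶠ[nhds (0, 0)] fun _ => 0 := by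
    filter_upwards [hUn] with p hp using hfn p hp
  have R3 : (fun p => dot (X.nu p) (X.nu p)) =ᶠ[nhds (0, 0)] fun _ => 1 := by
    filter_upwards [hUn] with p hp using hnn p hp
  have R1u := R1.Du.eq_of_nhds
  have R1v := R1.Dv
  have R2v := R2.Dv.eq_of_nhds
  have R2vv := R2.Dv.Dv.eq_of_nhds
  have R3v := R3.Dv.eq_of_nhds
  have c0 : ∀ r : ℝ, Dv (fun _ : ℝ × ℝ => r) = fun _ => 0 := fun r => by funext; simp [Dv]
  have c0' : ∀ r : ℝ, Du (fun _ : ℝ × ℝ => r) = fun _ => 0 := fun r => by funext; simp [Du]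
  have dadd : ∀ {b d : ℝ × ℝ → ℝ}, ContDiff ℝ ∞ b → ContDiff ℝ ∞ d →
      Dv (fun p => b p + d p) = fun p => Dv b p + Dv d p := fun hb hd => Dv_add hb hd
  have dneg : ∀ b : ℝ × ℝ → ℝ, Dv (fun p => -b p) = fun p => -Dv b p := fun b => by
    funext p; simp [Dv]
  rw [Du_dot hh hn, c0'] at R1u
  rw [Dv_dot hh hn, c0] at R1v
  rw [Dv_dot hfu hn, c0] at R2v
  rw [Dv_dot hfu hn, c0, c0, dadd (hfu.Dv.dot hn) (hfu.dot hn.Dv), Dv_dot hfu.Dv hn,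
    Dv_dot hfu hn.Dv] at R2vv
  rw [Dv_dot hn hn, c0] at R3v
  beta_reduce at R1u R2v R2vv R3v
  have hNt : X.Nt = fun p => -dot (X.h p) (Dv X.nu p) := rfl
  have hN1 : X.Nt =ᶠ[nhds (0, 0)] fun p => dot (Dv X.h p) (X.nu p) := by
    filter_upwards [R1v] with p hp
    rw [hNt]; linarith
  have N0 := hN1.eq_of_nhds
  have Nv := hN1.Dv.eq_of_nhds
  have Nvv := hN1.Dv.Dv.eq_of_nhds
  rw [Dv_dot hh.Dv hn] at Nv
  rw [Dv_dot hh.Dv hn, dadd (hh.Dv.Dv.dot hn) (hh.Dv.dot hn.Dv), Dv_dot hh.Dv.Dv hn,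
    Dv_dot hh.Dv hn.Dv] at Nvv
  beta_reduce at Nv Nvv
  have Nv' : Dv X.Nt (0, 0)
      = -(dot (Dv X.h (0, 0)) (Dv X.nu (0, 0)) + dot (X.h (0, 0)) (Dv (Dv X.nu) (0, 0))) := by
    rw [hNt, dneg, Dv_dot hh hn.Dv]
  have Gv : Dv X.Gt (0, 0) = 2 * dot (Dv X.h (0, 0)) (X.h (0, 0)) := by
    have : X.Gt = fun p => dot (X.h p) (X.h p) := rfl
    rw [this, Dv_dot hh hh]
    beta_reduce
    rw [dot_comm (X.h _)]; ring
  have Fv : Dv X.Ft (0, 0) = dot (Dv X.h (0, 0)) (Du X.f (0, 0)) := by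
    have : X.Ft = fun p => dot (Du X.f p) (X.h p) := rfl
    rw [this, Dv_dot hfu hh]
    beta_reduce
    rw [hfuv0, dot_comm (Du X.f _)]; simp [dot_eq]
  have hM : X.Mt (0, 0) = dot (Du X.h (0, 0)) (X.nu (0, 0)) := by
    simp only [FrontalData.Mt]; linarith
  -- iterated derivatives of `f` along the vector field
  set c : ℝ := -Dv X.Ft (0, 0) with hc
  have ha' : a = fun p => c * p.2 ^ 2 := by funext p; rw [ha, hc]; ring
  have hac : ContDiff ℝ ∞ a := ha' ▸ contDiff_const.mul (contDiff_snd.pow 2)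
  have hcf : ContDiff ℝ ∞ (c • Du X.f) := contDiff_const.smul hfu
  have hη : etaD a X.f =ᶠ[nhds (0, 0)]
      (Prod.snd : ℝ × ℝ → ℝ) • ((Prod.snd : ℝ × ℝ → ℝ) • (c • Du X.f) + X.h) := by
    filter_upwards [hfv'] with p hp
    simp only [etaD, hp, ha', Pi.smul_apply', Pi.smul_apply, Pi.add_apply]
    module
  obtain ⟨h2, h3, h4, h5⟩ := etaD_iterate_of_eventuallyEq hac hcf hh rfl hη
  obtain ⟨A1, A2, -⟩ := etaD_iterate_of_sq hcf ha' (p := (0, 0)) rfl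
  obtain ⟨B1, B2, B3⟩ := etaD_iterate_of_sq hh ha' (p := (0, 0)) rfl
  have dc : ∀ k : ℝ × ℝ → V3, ContDiff ℝ ∞ k → Dv (c • k) = c • Dv k := fun k hk => by
    funext p
    simp [Dv, fderiv_const_smul (hk.differentiableAt_of_smooth p)]
  rw [dc _ hfu] at A1 A2
  rw [dc _ hfu.Dv] at A2
  rw [B1] at h3
  rw [A1, B2] at h4
  rw [A2, B3] at h5
  simp only [Pi.smul_apply, hfuv0, hfuvv0, smul_zero, zero_add] at h3 h4 h5
  -- the frame at the origin
  have hE' : dot (Du X.f (0, 0)) (Du X.f (0, 0)) = 1 := hE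
  have hG' : dot (X.h (0, 0)) (X.h (0, 0)) = 1 := hG
  have hF' : dot (Du X.f (0, 0)) (X.h (0, 0)) = 0 := hF
  have hfn0 := hfn _ h0
  have hhn0 := hhn _ h0
  have hnn0 := hnn _ h0
  have hd0 := hdet _ h0
  have hF'' := (dot_comm _ _).trans hF'
  have hfn0' := (dot_comm _ _).trans hfn0
  have hhn0' := (dot_comm _ _).trans hhn0
  have hdet_eq := det3_eq_dot_of_orthonormal hE' hG' hF' hnn0 hfn0 hhn0 hpos
  rw [hnf] at N0
  have hνv : Dv X.nu (0, 0) = 0 := by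
    refine eq_zero_of_dot_eq_zero hd0 ?_ ?_ ?_
    · have : dot (0 : V3) (X.nu (0, 0)) = 0 := by simp [dot_eq]
      rw [hfuv0, this, zero_add] at R2v; exact R2v
    · have := hnf
      rw [hNt] at this; linarith
    · have := dot_comm (Dv X.nu (0, 0)) (X.nu (0, 0))
      linarith
  have hhv : Dv X.h (0, 0)
      = (Dv X.Gt (0, 0) / 2) • X.h (0, 0) + Dv X.Ft (0, 0) • Du X.f (0, 0) := by
    rw [← sub_eq_zero]
    refine eq_zero_of_dot_eq_zero hd0 ?_ ?_ ?_ <;>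
      rw [dot_comm, dot_sub_left, dot_add_left, dot_smul_left, dot_smul_left]
    · rw [← Fv, hF'', hE']; ring
    · rw [hG', hF', Gv]; ring
    · rw [← N0, hhn0, hfn0]; ring
  have z1 : ∀ x : V3, dot x 0 = 0 := fun x => by simp [dot_eq]
  simp only [hνv, hfuv0, hfuvv0, z1] at Nv Nvv Nv' R2vv
  have hhvνvv : dot (Dv X.h (0, 0)) (Dv (Dv X.nu) (0, 0))
      = -(Dv X.Gt (0, 0) / 2 * Dv X.Nt (0, 0)) - Dv X.Ft (0, 0) * X.Mt (0, 0) := by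
    rw [hhv, dot_add_left, dot_smul_left, dot_smul_left, hM]
    linear_combination (Dv X.Gt (0, 0) / 2) * Nv' + Dv X.Ft (0, 0) * R2vv
  have n1 : nrm (Du X.f (0, 0)) = 1 := by rw [nrm, hE', Real.sqrt_one]
  have n2 : nrm (cross3 (Du X.f (0, 0)) (X.h (0, 0))) = 1 := by
    rw [nrm, dot_cross3_self, hE', hG', hF']; simp
  refine ⟨?_, ?_, ?_⟩
  · rw [h3, h2, hhv, hc]
    module
  · rw [h2, n1, n2, hdet_eq, h4, dot_smul_left, Nv]
    ring
  · rw [h2, n1, n2, hdet_eq, h4, h5]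
    simp only [dot_sub_left, dot_smul_left, dot_add_left, Real.one_rpow, ← hM]
    linear_combination (-12) * Nvv - 12 * hhvνvv + 30 * Dv X.Gt (0, 0) * Nv
      + 60 * X.Mt (0, 0) * hc
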